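/- Define ψ₀(ω) = √(1 − ω²) − (1 − ω²/2)² for ω ∈ [0, 1]. Then ψ₀(0) = 0 and there exists a unique ω₀ ∈ (0, 1) with ψ₀(ω₀) = 0. -/

import Mathlib

/-- The nonzero roots of the incompressible Rayleigh function are the roots of a cubic in the
variable `s = √(1 - ω²)`. -/
lemma rayleigh_eq_zero_iff_cubic {ω : ℝ} (hω : ω ∈ Set.Ioo (0 : ℝ) 1) :
    Real.sqrt (1 - ω ^ 2) - (1 - ω ^ 2 / 2) ^ 2 = 0 ↔
      Real.sqrt (1 - ω ^ 2) ^ 3 + Real.sqrt (1 - ω ^ 2) ^ 2 + 3 * Real.sqrt (1 - ω ^ 2) = 1 := by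
  obtain ⟨h0, h1⟩ := hω
  have hs := Real.sq_sqrt (show (0 : ℝ) ≤ 1 - ω ^ 2 by nlinarith)
  set s := Real.sqrt (1 - ω ^ 2)
  have hne : s - 1 ≠ 0 := by
    intro h
    have : s = 1 := by linarith
    rw [this] at hs
    nlinarith
  have hω2 : ω ^ 2 = 1 - s ^ 2 := by linarith
  have key : s - (1 - ω ^ 2 / 2) ^ 2 = -(1 / 4) * ((s - 1) * (s ^ 3 + s ^ 2 + 3 * s - 1)) := by
    rw [hω2]; ring
  rw [key]
  simp [hne, sub_eq_zero]

lemma exists_cubic_root : ∃ s ∈ Set.Ioo (0 : ℝ) 1, s ^ 3 + s ^ 2 + 3 * s = 1 :=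
  intermediate_value_Ioo (f := fun s : ℝ => s ^ 3 + s ^ 2 + 3 * s) zero_le_one (by fun_prop)
    (by norm_num)

lemma cubic_injOn : Set.InjOn (fun s : ℝ => s ^ 3 + s ^ 2 + 3 * s) (Set.Ici 0) := by
  refine StrictMonoOn.injOn fun s (hs : 0 ≤ s) t _ hst => ?_
  gcongr

/-- The incompressible-limit Rayleigh function `ψ₀(ω) = √(1−ω²) − (1−ω²/2)²` satisfies
`ψ₀(0) = 0` and has a unique root `ω₀ ∈ (0,1)`. -/
theorem rayleigh_function_incompressible_limit_root :
    let ψ₀ : ℝ → ℝ := fun ω => Real.sqrt (1 - ω ^ 2) - (1 - ω ^ 2 / 2) ^ 2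
    ψ₀ 0 = 0 ∧ ∃! ω₀ : ℝ, ω₀ ∈ Set.Ioo (0 : ℝ) 1 ∧ ψ₀ ω₀ = 0 := by
  refine ⟨by norm_num, ?_⟩
  obtain ⟨s, ⟨hs0, hs1⟩, hs⟩ := exists_cubic_root
  have hmem : Real.sqrt (1 - s ^ 2) ∈ Set.Ioo (0 : ℝ) 1 :=
    ⟨Real.sqrt_pos.2 (by nlinarith), (Real.sqrt_lt' one_pos).2 (by nlinarith)⟩
  have hsqrt : Real.sqrt (1 - Real.sqrt (1 - s ^ 2) ^ 2) = s := by
    rw [Real.sq_sqrt (by nlinarith), sub_sub_cancel, Real.sqrt_sq hs0.le]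
  refine ⟨Real.sqrt (1 - s ^ 2), ⟨hmem, ?_⟩, ?_⟩
  · exact (rayleigh_eq_zero_iff_cubic hmem).2 (by rw [hsqrt]; exact hs)
  · rintro ω ⟨hω, hroot⟩
    have heq : Real.sqrt (1 - ω ^ 2) = s :=
      cubic_injOn (Real.sqrt_nonneg _) hs0.le
        (((rayleigh_eq_zero_iff_cubic hω).1 hroot).trans hs.symm)
    rw [← heq, Real.sq_sqrt (by nlinarith [hω.1, hω.2]), sub_sub_cancel, Real.sqrt_sq hω.1.le]
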